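/- Let χ be a weighted game on n voters with exactly two types of voters, without null voters, and with at least two distinct types of shift-minimal winning coalitions (r ≥ 2). Then there exists a triple (ŵ1, ŵ2, q̂) of nonnegative integers that is LP-feasible and such that every LP-feasible triple (w1, w2, q) of nonnegative reals satisfies w1 ≥ ŵ1, w2 ≥ ŵ2 and q ≥ q̂. -/

import Mathlib

def SimpleGame (n : ℕ) (χ : Finset (Fin n) → Prop) : Prop :=
  (∀ U V : Finset (Fin n), U ⊆ V → χ U → χ V) ∧ ¬ χ (∅ : Finset (Fin n)) ∧ χ Finset.univ

def IsRep {n : ℕ} (χ : Finset (Fin n) → Prop) (q : ℕ) (w : Fin n → ℕ) : Prop :=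
  ∀ U : Finset (Fin n), χ U ↔ q ≤ ∑ i ∈ U, w i

def IsWeighted {n : ℕ} (χ : Finset (Fin n) → Prop) : Prop :=
  ∃ q w, IsRep χ q w

def MinRep {n : ℕ} (χ : Finset (Fin n) → Prop) (q : ℕ) (w : Fin n → ℕ) : Prop :=
  IsRep χ q w ∧ ∀ q' w', IsRep χ q' w' → ∀ i, w i ≤ w' i

def Desir {n : ℕ} (χ : Finset (Fin n) → Prop) (i j : Fin n) : Prop :=
  ∀ U : Finset (Fin n), j ∈ U → i ∉ U → χ U → χ (insert i (U.erase j))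

def VEquiv {n : ℕ} (χ : Finset (Fin n) → Prop) (i j : Fin n) : Prop :=
  Desir χ i j ∧ Desir χ j i

def StrictDesir {n : ℕ} (χ : Finset (Fin n) → Prop) (i j : Fin n) : Prop :=
  Desir χ i j ∧ ¬ Desir χ j i

def NullVoter {n : ℕ} (χ : Finset (Fin n) → Prop) (i : Fin n) : Prop :=
  ∀ U : Finset (Fin n), χ (insert i U) ↔ χ U

def ShiftMinWin {n : ℕ} (χ : Finset (Fin n) → Prop) (U : Finset (Fin n)) : Prop :=
  χ U ∧ (∀ i ∈ U, ¬ χ (U.erase i)) ∧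
    ∀ i ∈ U, ∀ j, j ∉ U → StrictDesir χ i j → ¬ χ (insert j (U.erase i))

def ShiftMaxLose {n : ℕ} (χ : Finset (Fin n) → Prop) (U : Finset (Fin n)) : Prop :=
  ¬ χ U ∧ (∀ j, j ∉ U → χ (insert j U)) ∧
    ∀ j ∈ U, ∀ i, i ∉ U → StrictDesir χ i j → χ (insert i (U.erase j))

def TwoTypes {n : ℕ} (χ : Finset (Fin n) → Prop) (N1 N2 : Finset (Fin n)) : Prop :=
  N1.Nonempty ∧ N2.Nonempty ∧ Disjoint N1 N2 ∧ N1 ∪ N2 = Finset.univ ∧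
  (∀ i ∈ N1, ∀ j ∈ N1, VEquiv χ i j) ∧
  (∀ i ∈ N2, ∀ j ∈ N2, VEquiv χ i j) ∧
  (∀ i ∈ N1, ∀ j ∈ N2, StrictDesir χ i j)

noncomputable def NumWinTypes2 {n : ℕ} (χ : Finset (Fin n) → Prop) (N1 N2 : Finset (Fin n)) : ℕ :=
  Set.ncard {p : ℕ × ℕ | ∃ U, ShiftMinWin χ U ∧ p = ((U ∩ N1).card, (U ∩ N2).card)}

def LPFeasible {n : ℕ} (χ : Finset (Fin n) → Prop) (N1 N2 : Finset (Fin n))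
    (w1 w2 q : ℝ) : Prop :=
  0 ≤ w1 ∧ 0 ≤ w2 ∧ 0 ≤ q ∧
  (∀ U, ShiftMinWin χ U → q ≤ ((U ∩ N1).card : ℝ) * w1 + ((U ∩ N2).card : ℝ) * w2) ∧
  (∀ U, ShiftMaxLose χ U → ((U ∩ N1).card : ℝ) * w1 + ((U ∩ N2).card : ℝ) * w2 ≤ q - 1)

def GameIso (n : ℕ) (χ χ' : Finset (Fin n) → Prop) : Prop :=
  ∃ σ : Equiv.Perm (Fin n), ∀ U : Finset (Fin n), χ' U ↔ χ (U.image σ)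

noncomputable def NumTypes (n : ℕ) (χ : Finset (Fin n) → Prop) : ℕ :=
  Set.ncard {S : Set (Fin n) | ∃ i, S = {j | VEquiv χ i j}}

noncomputable def ClassCount (n : ℕ) (χ : Finset (Fin n) → Prop) (U : Finset (Fin n)) (i : Fin n) : ℕ :=
  Set.ncard {j : Fin n | j ∈ U ∧ VEquiv χ i j}

def SameType (n : ℕ) (χ : Finset (Fin n) → Prop) (U V : Finset (Fin n)) : Prop :=
  ∀ i, ClassCount n χ U i = ClassCount n χ V i

noncomputable def NumSMWTypes (n : ℕ) (χ : Finset (Fin n) → Prop) : ℕ :=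
  Set.ncard {T : Set (Finset (Fin n)) | ∃ U, ShiftMinWin χ U ∧
    T = {V | ShiftMinWin χ V ∧ SameType n χ U V}}

noncomputable def wmntr (n t r : ℕ) : ℕ :=
  Set.ncard {C : Set (Finset (Fin n) → Prop) | ∃ χ, SimpleGame n χ ∧ IsWeighted χ ∧
    NumTypes n χ = t ∧ NumSMWTypes n χ = r ∧ C = {χ' | GameIso n χ χ'}}

noncomputable def wmnt (n t : ℕ) : ℕ :=
  Set.ncard {C : Set (Finset (Fin n) → Prop) | ∃ χ, SimpleGame n χ ∧ IsWeighted χ ∧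
    NumTypes n χ = t ∧ C = {χ' | GameIso n χ χ'}}

def PreservesTypes {n : ℕ} (χ : Finset (Fin n) → Prop) (w : Fin n → ℕ) : Prop :=
  ∀ i j, VEquiv χ i j → w i = w j

def MinRepPT {n : ℕ} (χ : Finset (Fin n) → Prop) (q : ℕ) (w : Fin n → ℕ) : Prop :=
  IsRep χ q w ∧ PreservesTypes χ w ∧
    ∀ q' w', IsRep χ q' w' → PreservesTypes χ w' → ∀ i, w i ≤ w' i

def Repre (a b k : ℕ) : Prop := ∃ u v : ℕ, u * a + v * b = k

def Wvec (t a b : ℕ) (l : Fin t → ℕ) (k : Fin t) : Fin (t + b + a) → ℕ :=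
  fun i => if h : (i : ℕ) < t then
      (a * b - l ⟨(i : ℕ), h⟩ - 1) + (if (i : ℕ) = (k : ℕ) then 0 else 1)
    else if (i : ℕ) < t + b then a else b

section aux

variable {n : ℕ} {χ : Finset (Fin n) → Prop} {N1 N2 : Finset (Fin n)}

lemma aux_tight {ι : Type*} [Finite ι] (g e : ι → ℝ) (x : ℝ) (hx : 0 < x)
    (h : ∀ i, 1 ≤ g i + e i * x)
    (hmin : ∀ y, 0 ≤ y → (∀ i, 1 ≤ g i + e i * y) → x ≤ y) :
    ∃ i, 0 < e i ∧ g i + e i * x = 1 := by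
  by_contra! hc
  have h1 : ∀ᶠ y in nhdsWithin x (Set.Iio x), ∀ i, 1 ≤ g i + e i * y := by
    rw [Filter.eventually_all]
    intro i
    rcases lt_or_ge 0 (e i) with hi | hi
    · have hlt : 1 < g i + e i * x := lt_of_le_of_ne (h i) (Ne.symm (hc i hi))
      have hcont : Continuous (fun y : ℝ => g i + e i * y) := by fun_prop
      have := (hcont.tendsto x).eventually (lt_mem_nhds hlt)
      exact (this.filter_mono nhdsWithin_le_nhds).mono fun y hy => hy.le
    · filter_upwards [self_mem_nhdsWithin] with y hy
      have hy' : y < x := hy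
      have := h i
      nlinarith
  have h2 : ∀ᶠ y in nhdsWithin x (Set.Iio x), 0 < y :=
    (lt_mem_nhds hx).filter_mono nhdsWithin_le_nhds
  have h3 : ∀ᶠ y in nhdsWithin x (Set.Iio x), y < x := self_mem_nhdsWithin
  obtain ⟨y, hy1, hy2, hy3⟩ := (h1.and (h2.and h3)).exists
  exact absurd (hmin y hy2.le hy1) (not_le.mpr hy3)

lemma aux_conv (a b c s t N : ℝ) (hs : 0 ≤ s) (ht : 0 ≤ t) (hst : s + t ≤ 1)
    (ha : 0 ≤ a) (hb : 0 ≤ b) (hc : 0 ≤ c) (ha' : a ≤ N) (hb' : b ≤ N) (hc' : c ≤ N) :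
    0 ≤ a + s * (b - a) + t * (c - a) ∧ a + s * (b - a) + t * (c - a) ≤ N := by
  have h0 : 0 ≤ 1 - s - t := by linarith
  constructor
  · nlinarith [mul_nonneg h0 ha, mul_nonneg hs hb, mul_nonneg ht hc]
  · nlinarith [mul_nonneg h0 (sub_nonneg.2 ha'), mul_nonneg hs (sub_nonneg.2 hb'),
      mul_nonneg ht (sub_nonneg.2 hc')]

lemma aux_tri (n1 n2 : ℤ) (w1 w2 q : ℝ) (hw : w2 ≠ 0) (a1 a2 b1 b2 c1 c2 : ℤ)
    (ha1 : 0 ≤ a1 ∧ a1 ≤ n1) (ha2 : 0 ≤ a2 ∧ a2 ≤ n2)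
    (hb1 : 0 ≤ b1 ∧ b1 ≤ n1) (hb2 : 0 ≤ b2 ∧ b2 ≤ n2)
    (hc1 : 0 ≤ c1 ∧ c1 ≤ n1) (hc2 : 0 ≤ c2 ∧ c2 ≤ n2)
    (hstrip : ∀ x y : ℤ, 0 ≤ x → x ≤ n1 → 0 ≤ y → y ≤ n2 →
      ¬ (q - 1 < x * w1 + y * w2 ∧ x * w1 + y * w2 < q))
    (hfa : a1 * w1 + a2 * w2 = q) (hfb : b1 * w1 + b2 * w2 = q)
    (hab : ¬ (a1 = b1 ∧ a2 = b2)) (hfc : c1 * w1 + c2 * w2 = q - 1) (e1 e2 : ℤ) :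
    ∃ k : ℤ, e1 * w1 + e2 * w2 = k := by
  -- any lattice vector `s u + t v` with `s,t ≥ 0`, `s+t ≤ 1` has `t ∉ (0,1)`
  have key : ∀ (s t : ℝ) (p1 p2 : ℤ), 0 ≤ s → 0 < t → t < 1 → s + t ≤ 1 →
      (p1 : ℝ) = s * (b1 - a1) + t * (c1 - a1) → (p2 : ℝ) = s * (b2 - a2) + t * (c2 - a2) →
      False := by
    intro s t p1 p2 hs ht ht1 hst hp1 hp2
    have k1 := aux_conv a1 b1 c1 s t n1 hs ht.le hst (by exact_mod_cast ha1.1)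
      (by exact_mod_cast hb1.1) (by exact_mod_cast hc1.1) (by exact_mod_cast ha1.2)
      (by exact_mod_cast hb1.2) (by exact_mod_cast hc1.2)
    have k2 := aux_conv a2 b2 c2 s t n2 hs ht.le hst (by exact_mod_cast ha2.1)
      (by exact_mod_cast hb2.1) (by exact_mod_cast hc2.1) (by exact_mod_cast ha2.2)
      (by exact_mod_cast hb2.2) (by exact_mod_cast hc2.2)
    rw [add_assoc, ← hp1] at k1
    rw [add_assoc, ← hp2] at k2
    have hval : ((a1 + p1 : ℤ) : ℝ) * w1 + ((a2 + p2 : ℤ) : ℝ) * w2 = q - t := by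
      push_cast
      rw [hp1, hp2]
      linear_combination (1 - s - t) * hfa + s * hfb + t * hfc
    refine hstrip (a1 + p1) (a2 + p2) (by exact_mod_cast k1.1) (by exact_mod_cast k1.2)
      (by exact_mod_cast k2.1) (by exact_mod_cast k2.2) ?_
    rw [hval]
    constructor <;> linarith
  have hu : (b1 : ℝ) - a1 ≠ 0 := by
    intro h0
    apply hab
    have h1 : (b1 : ℝ) = a1 := by linarith
    have h2 : ((b2 : ℝ) - a2) * w2 = 0 := by rw [h1] at hfb; linarith
    have h3 : (b2 : ℝ) - a2 = 0 := by
      rcases mul_eq_zero.mp h2 with h | h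
      · exact h
      · exact absurd h hw
    constructor
    · exact_mod_cast h1.symm
    · have : (a2 : ℝ) = b2 := by linarith
      exact_mod_cast this
  obtain ⟨β, hβ⟩ : ∃ β : ℝ, β = -(e1 * w1 + e2 * w2) := ⟨_, rfl⟩
  obtain ⟨α, hα⟩ : ∃ α : ℝ, α = (e1 - β * (c1 - a1)) / (b1 - a1) := ⟨_, rfl⟩
  have he1 : (e1 : ℝ) = α * (b1 - a1) + β * (c1 - a1) := by
    rw [hα]; field_simp; ring
  have he2 : (e2 : ℝ) = α * (b2 - a2) + β * (c2 - a2) := by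
    have : ((e2 : ℝ) - (α * (b2 - a2) + β * (c2 - a2))) * w2 = 0 := by
      linear_combination hβ - w1 * he1 - α * hfb + (α + β) * hfa - β * hfc
    rcases mul_eq_zero.mp this with h | h
    · linarith
    · exact absurd h hw
  have hfα := Int.floor_add_fract α
  have hfβ := Int.floor_add_fract β
  have hsα := Int.fract_nonneg α
  have hsα' := Int.fract_lt_one α
  have hsβ := Int.fract_nonneg β
  have hsβ' := Int.fract_lt_one β
  rcases hsβ.eq_or_lt with h0 | h0
  · refine ⟨-⌊β⌋, ?_⟩
    push_cast
    linarith
  · exfalso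
    rcases le_or_gt (Int.fract α + Int.fract β) 1 with hle | hgt
    · refine key (Int.fract α) (Int.fract β) (e1 - ⌊α⌋ * (b1 - a1) - ⌊β⌋ * (c1 - a1))
        (e2 - ⌊α⌋ * (b2 - a2) - ⌊β⌋ * (c2 - a2)) hsα h0 hsβ' hle ?_ ?_
      · push_cast
        linear_combination he1 - (b1 - a1) * hfα - (c1 - a1) * hfβ
      · push_cast
        linear_combination he2 - (b2 - a2) * hfα - (c2 - a2) * hfβ
    · refine key (1 - Int.fract α) (1 - Int.fract β)
        ((b1 - a1) + (c1 - a1) - (e1 - ⌊α⌋ * (b1 - a1) - ⌊β⌋ * (c1 - a1)))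
        ((b2 - a2) + (c2 - a2) - (e2 - ⌊α⌋ * (b2 - a2) - ⌊β⌋ * (c2 - a2)))
        (by linarith) (by linarith) (by linarith) (by linarith) ?_ ?_
      · push_cast
        linear_combination -he1 + (b1 - a1) * hfα + (c1 - a1) * hfβ
      · push_cast
        linear_combination -he2 + (b2 - a2) * hfα + (c2 - a2) * hfβ

lemma aux_avg {α : Type*} [DecidableEq α] (w : α → ℝ) (m : ℕ) : ∀ (N : Finset α), N.card = m →
    ∀ k ≤ m, ∃ S ⊆ N, S.card = k ∧ (m : ℝ) * ∑ i ∈ S, w i ≤ k * ∑ i ∈ N, w i := by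
  induction m with
  | zero =>
    intro N hN k hk
    refine ⟨N, subset_rfl, by omega, ?_⟩
    have : k = 0 := by omega
    subst this; simp
  | succ m ih =>
    intro N hN k hk
    rcases Nat.lt_or_ge m k with h | h
    · have : k = m + 1 := by omega
      subst this
      exact ⟨N, subset_rfl, hN, le_rfl⟩
    · have hne : N.Nonempty := by rw [← Finset.card_pos]; omega
      obtain ⟨x, hx, hmax⟩ := Finset.exists_max_image N w hne
      have hc : (N.erase x).card = m := by rw [Finset.card_erase_of_mem hx]; omega
      obtain ⟨S, hS, hSk, hSw⟩ := ih (N.erase x) hc k h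
      refine ⟨S, hS.trans (Finset.erase_subset _ _), hSk, ?_⟩
      have hsum := Finset.add_sum_erase N w hx
      have hle : ∑ i ∈ N.erase x, w i ≤ m * w x := by
        calc ∑ i ∈ N.erase x, w i ≤ ∑ i ∈ N.erase x, w x :=
              Finset.sum_le_sum fun i hi => hmax i (Finset.mem_of_mem_erase hi)
          _ = m * w x := by simp [hc]
      have hSx : ∑ i ∈ S, w i ≤ k * w x := by
        calc ∑ i ∈ S, w i ≤ ∑ i ∈ S, w x :=
              Finset.sum_le_sum fun i hi => hmax i (Finset.mem_of_mem_erase (hS hi))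
          _ = k * w x := by simp [hSk]
      rw [← hsum]
      push_cast
      nlinarith

lemma aux_card (h2 : TwoTypes χ N1 N2) (U : Finset (Fin n)) :
    U.card = (U ∩ N1).card + (U ∩ N2).card := by
  obtain ⟨-, -, hd, hu, -⟩ := h2
  rw [← Finset.card_union_of_disjoint, ← Finset.inter_union_distrib_left, hu, Finset.inter_univ]
  exact hd.mono Finset.inter_subset_right Finset.inter_subset_right

lemma aux_mem (h2 : TwoTypes χ N1 N2) (i : Fin n) : i ∈ N1 ∨ i ∈ N2 := by
  have := Finset.mem_univ i
  rw [← h2.2.2.2.1] at this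
  exact Finset.mem_union.mp this

lemma aux_notmem (h2 : TwoTypes χ N1 N2) (i : Fin n) (h : i ∈ N1) : i ∉ N2 :=
  Finset.disjoint_left.mp h2.2.2.1 h

lemma aux_dom (hsg : SimpleGame n χ) (h2 : TwoTypes χ N1 N2) : ∀ (d : ℕ) (U V : Finset (Fin n)),
    (U \ V).card = d → (U ∩ N1).card ≤ (V ∩ N1).card → U.card ≤ V.card → χ U → χ V := by
  intro d
  induction d with
  | zero =>
    intro U V hd _ _ hU
    exact hsg.1 U V (Finset.sdiff_eq_empty_iff_subset.mp (Finset.card_eq_zero.mp hd)) hU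
  | succ d ih =>
    intro U V hd h1 hc hU
    -- it suffices to find a good swap
    have swap : ∀ i j, j ∈ U → j ∉ V → i ∈ V → i ∉ U → Desir χ i j →
        ((insert i (U.erase j)) ∩ N1).card ≤ (V ∩ N1).card → χ V := by
      intro i j hjU hjV hiV hiU hD hle
      have hi' : i ∉ U.erase j := fun h => hiU (Finset.mem_of_mem_erase h)
      refine ih (insert i (U.erase j)) V ?_ hle ?_ (hD U hjU hiU hU)
      · have : (insert i (U.erase j)) \ V = (U \ V).erase j := by
          ext x
          simp only [Finset.mem_sdiff, Finset.mem_insert, Finset.mem_erase]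
          constructor
          · rintro ⟨rfl | ⟨hx, hx'⟩, hxV⟩
            · exact absurd hiV hxV
            · exact ⟨hx, hx', hxV⟩
          · rintro ⟨hx, hx', hxV⟩
            exact ⟨Or.inr ⟨hx, hx'⟩, hxV⟩
        rw [this, Finset.card_erase_of_mem (Finset.mem_sdiff.mpr ⟨hjU, hjV⟩), hd]
        rfl
      · rw [Finset.card_insert_of_notMem hi', Finset.card_erase_of_mem hjU]
        have := Finset.card_pos.mpr ⟨j, hjU⟩
        omega
    by_cases hA : ∃ j ∈ U, j ∉ V ∧ j ∈ N1
    · obtain ⟨j, hjU, hjV, hj1⟩ := hA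
      have : ∃ i ∈ V ∩ N1, i ∉ U ∩ N1 := by
        by_contra! hcon
        have hsub : V ∩ N1 ⊆ (U ∩ N1).erase j := by
          intro x hx
          refine Finset.mem_erase.mpr ⟨?_, hcon x hx⟩
          rintro rfl
          exact hjV (Finset.mem_inter.mp hx).1
        have hle := Finset.card_le_card hsub
        have hj : j ∈ U ∩ N1 := Finset.mem_inter.mpr ⟨hjU, hj1⟩
        rw [Finset.card_erase_of_mem hj] at hle
        have := Finset.card_pos.mpr ⟨j, hj⟩
        omega
      obtain ⟨i, hi, hi'⟩ := this
      obtain ⟨hiV, hi1⟩ := Finset.mem_inter.mp hi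
      have hiU : i ∉ U := fun h => hi' (Finset.mem_inter.mpr ⟨h, hi1⟩)
      refine swap i j hjU hjV hiV hiU (h2.2.2.2.2.1 i hi1 j hj1).1 ?_
      have : (insert i (U.erase j)) ∩ N1 = insert i ((U ∩ N1).erase j) := by
        rw [Finset.insert_inter_of_mem hi1, Finset.erase_inter]
      rw [this]
      have hj : j ∈ U ∩ N1 := Finset.mem_inter.mpr ⟨hjU, hj1⟩
      have h3 := Finset.card_insert_le i ((U ∩ N1).erase j)
      rw [Finset.card_erase_of_mem hj] at h3
      have := Finset.card_pos.mpr ⟨j, hj⟩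
      omega
    · push Not at hA
      have hne : (U \ V).Nonempty := by rw [← Finset.card_pos]; omega
      obtain ⟨j, hj⟩ := hne
      obtain ⟨hjU, hjV⟩ := Finset.mem_sdiff.mp hj
      have hj2 : j ∈ N2 := (aux_mem h2 j).resolve_left (hA j hjU hjV)
      have : ∃ i ∈ V, i ∉ U := by
        by_contra! hcon
        have hsub : V ⊆ U.erase j := by
          intro x hx
          refine Finset.mem_erase.mpr ⟨?_, hcon x hx⟩
          rintro rfl
          exact hjV hx
        have hle := Finset.card_le_card hsub
        rw [Finset.card_erase_of_mem hjU] at hle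
        have := Finset.card_pos.mpr ⟨j, hjU⟩
        omega
      obtain ⟨i, hiV, hiU⟩ := this
      have hD : Desir χ i j := by
        rcases aux_mem h2 i with hi | hi
        · exact (h2.2.2.2.2.2.2 i hi j hj2).1
        · exact (h2.2.2.2.2.2.1 i hi j hj2).1
      refine swap i j hjU hjV hiV hiU hD (Finset.card_le_card ?_)
      intro x hx
      obtain ⟨hx, hx1⟩ := Finset.mem_inter.mp hx
      refine Finset.mem_inter.mpr ⟨?_, hx1⟩
      rcases Finset.mem_insert.mp hx with rfl | hx
      · exact hiV
      · by_contra hxV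
        exact hA x (Finset.mem_of_mem_erase hx) hxV hx1

lemma aux_dom' (hsg : SimpleGame n χ) (h2 : TwoTypes χ N1 N2) (U V : Finset (Fin n))
    (h1 : (U ∩ N1).card ≤ (V ∩ N1).card)
    (hc : (U ∩ N1).card + (U ∩ N2).card ≤ (V ∩ N1).card + (V ∩ N2).card) (hU : χ U) : χ V :=
  aux_dom hsg h2 _ U V rfl h1 (by rw [aux_card h2 U, aux_card h2 V]; exact hc) hU

lemma aux_strict (h2 : TwoTypes χ N1 N2) {i j : Fin n} (h : StrictDesir χ i j) :
    i ∈ N1 ∧ j ∈ N2 := by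
  have hi := aux_mem h2 i
  have hj := aux_mem h2 j
  obtain ⟨-, -, -, -, h11, h22, h12⟩ := h2
  rcases hi with hi | hi <;> rcases hj with hj | hj
  · exact absurd (h11 i hi j hj).2 h.2
  · exact ⟨hi, hj⟩
  · exact absurd h.1 (h12 j hj i hi).2
  · exact absurd (h22 i hi j hj).2 h.2

lemma aux_shift_card (h2 : TwoTypes χ N1 N2) {i j : Fin n} {U : Finset (Fin n)}
    (hi1 : i ∈ N1) (hj2 : j ∈ N2) (hi : i ∈ U) (hj : j ∉ U) :
    ((insert j (U.erase i)) ∩ N1).card + 1 = (U ∩ N1).card ∧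
    (insert j (U.erase i)).card = U.card := by
  have hj1 : j ∉ N1 := fun h => aux_notmem h2 j h hj2
  constructor
  · rw [Finset.insert_inter_of_notMem hj1, Finset.erase_inter]
    exact Finset.card_erase_add_one (Finset.mem_inter.mpr ⟨hi, hi1⟩)
  · rw [Finset.card_insert_of_notMem (fun h => hj (Finset.mem_of_mem_erase h))]
    exact Finset.card_erase_add_one hi

lemma aux_shift_card' (h2 : TwoTypes χ N1 N2) {i j : Fin n} {U : Finset (Fin n)}
    (hi1 : i ∈ N1) (hj2 : j ∈ N2) (hi : i ∉ U) (hj : j ∈ U) :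
    ((insert i (U.erase j)) ∩ N1).card = (U ∩ N1).card + 1 ∧
    (insert i (U.erase j)).card = U.card := by
  have hj1 : j ∉ N1 := fun h => aux_notmem h2 j h hj2
  constructor
  · rw [Finset.insert_inter_of_mem hi1, Finset.erase_inter,
      Finset.erase_eq_of_notMem (fun h => hj1 (Finset.mem_inter.mp h).2),
      Finset.card_insert_of_notMem (fun h => hi (Finset.mem_inter.mp h).1)]
  · rw [Finset.card_insert_of_notMem (fun h => hi (Finset.mem_of_mem_erase h))]
    exact Finset.card_erase_add_one hj

lemma aux_min (h2 : TwoTypes χ N1 N2) (V : Finset (Fin n)) (hV : χ V) :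
    ∃ U, ShiftMinWin χ U ∧ (U ∩ N1).card ≤ (V ∩ N1).card ∧
      (U ∩ N1).card + (U ∩ N2).card ≤ (V ∩ N1).card + (V ∩ N2).card := by
  classical
  let S := Finset.univ.filter fun U : Finset (Fin n) =>
    χ U ∧ (U ∩ N1).card ≤ (V ∩ N1).card ∧ U.card ≤ V.card
  obtain ⟨U, hU, hmin⟩ := Finset.exists_min_image S (fun U => (U ∩ N1).card + U.card)
    ⟨V, by simp [S, hV]⟩
  simp only [S, Finset.mem_filter, Finset.mem_univ, true_and] at hU hmin
  obtain ⟨hχ, hU1, hUc⟩ := hU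
  refine ⟨U, ⟨hχ, ?_, ?_⟩, hU1, by rw [← aux_card h2, ← aux_card h2]; exact hUc⟩
  · intro i hi hc
    have e1 := Finset.card_erase_add_one hi
    have e2 : (U.erase i ∩ N1).card ≤ (U ∩ N1).card :=
      Finset.card_le_card (Finset.inter_subset_inter_right (Finset.erase_subset _ _))
    have := hmin _ ⟨hc, by omega, by omega⟩
    omega
  · intro i hi j hj hs hc
    obtain ⟨hi1, hj2⟩ := aux_strict h2 hs
    obtain ⟨e1, e2⟩ := aux_shift_card h2 hi1 hj2 hi hj
    have := hmin _ ⟨hc, by omega, by omega⟩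
    omega

lemma aux_max (h2 : TwoTypes χ N1 N2) (V : Finset (Fin n)) (hV : ¬ χ V) :
    ∃ U, ShiftMaxLose χ U ∧ (V ∩ N1).card ≤ (U ∩ N1).card ∧
      (V ∩ N1).card + (V ∩ N2).card ≤ (U ∩ N1).card + (U ∩ N2).card := by
  classical
  let S := Finset.univ.filter fun U : Finset (Fin n) =>
    ¬ χ U ∧ (V ∩ N1).card ≤ (U ∩ N1).card ∧ V.card ≤ U.card
  obtain ⟨U, hU, hmax⟩ := Finset.exists_max_image S (fun U => (U ∩ N1).card + U.card)
    ⟨V, by simp [S, hV]⟩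
  simp only [S, Finset.mem_filter, Finset.mem_univ, true_and] at hU hmax
  obtain ⟨hχ, hU1, hUc⟩ := hU
  refine ⟨U, ⟨hχ, ?_, ?_⟩, hU1, by rw [← aux_card h2, ← aux_card h2]; exact hUc⟩
  · intro j hj
    by_contra hc
    have e1 := Finset.card_insert_of_notMem hj
    have e2 : (U ∩ N1).card ≤ (insert j U ∩ N1).card :=
      Finset.card_le_card (Finset.inter_subset_inter_right (Finset.subset_insert _ _))
    have := hmax _ ⟨hc, by omega, by omega⟩
    omega
  · intro j hj i hi hs
    by_contra hc
    obtain ⟨hi1, hj2⟩ := aux_strict h2 hs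
    obtain ⟨e1, e2⟩ := aux_shift_card' h2 hi1 hj2 hi hj
    have := hmax _ ⟨hc, by omega, by omega⟩
    omega

lemma aux_union (h2 : TwoTypes χ N1 N2) {S1 S2 : Finset (Fin n)} (h1 : S1 ⊆ N1) (h2' : S2 ⊆ N2) :
    (S1 ∪ S2) ∩ N1 = S1 ∧ (S1 ∪ S2) ∩ N2 = S2 := by
  have hd := fun i => aux_notmem h2 i
  constructor
  · ext x
    simp only [Finset.mem_inter, Finset.mem_union]
    constructor
    · rintro ⟨h | h, hx⟩
      · exact h
      · exact absurd (h2' h) (hd x hx)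
    · exact fun h => ⟨Or.inl h, h1 h⟩
  · ext x
    simp only [Finset.mem_inter, Finset.mem_union]
    constructor
    · rintro ⟨h | h, hx⟩
      · exact absurd hx (hd x (h1 h))
      · exact h
    · exact fun h => ⟨Or.inr h, h2' h⟩

lemma aux_exists (h2 : TwoTypes χ N1 N2) (a b : ℕ) (ha : a ≤ N1.card) (hb : b ≤ N2.card) :
    ∃ U : Finset (Fin n), (U ∩ N1).card = a ∧ (U ∩ N2).card = b := by
  obtain ⟨S1, hS1, h1⟩ := Finset.exists_subset_card_eq ha
  obtain ⟨S2, hS2, h2'⟩ := Finset.exists_subset_card_eq hb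
  obtain ⟨e1, e2⟩ := aux_union h2 hS1 hS2
  exact ⟨S1 ∪ S2, by rw [e1, h1], by rw [e2, h2']⟩

lemma aux_le1 (U : Finset (Fin n)) : (U ∩ N1).card ≤ N1.card :=
  Finset.card_le_card Finset.inter_subset_right

/-- In a shift-minimal winning coalition, any type strictly dominated is losing. -/
lemma aux_smw (hsg : SimpleGame n χ) (h2 : TwoTypes χ N1 N2) {U V : Finset (Fin n)}
    (hU : ShiftMinWin χ U) (hV : χ V) (h1 : (V ∩ N1).card ≤ (U ∩ N1).card)
    (hc : (V ∩ N1).card + (V ∩ N2).card ≤ (U ∩ N1).card + (U ∩ N2).card) :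
    (V ∩ N1).card = (U ∩ N1).card ∧ (V ∩ N2).card = (U ∩ N2).card := by
  by_contra hne
  obtain ⟨hχ, he, hs⟩ := hU
  rcases h1.lt_or_eq with h | h
  · have : (U ∩ N1).Nonempty := by rw [← Finset.card_pos]; omega
    obtain ⟨i, hi⟩ := this
    obtain ⟨hiU, hi1⟩ := Finset.mem_inter.mp hi
    by_cases hj : ∃ j ∈ N2, j ∉ U
    · obtain ⟨j, hj2, hjU⟩ := hj
      apply hs i hiU j hjU (h2.2.2.2.2.2.2 i hi1 j hj2)
      obtain ⟨e1, e2⟩ := aux_shift_card h2 hi1 hj2 hiU hjU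
      refine aux_dom hsg h2 _ V _ rfl (by omega) ?_ hV
      rw [e2, aux_card h2 V, aux_card h2 U]; exact hc
    · push Not at hj
      apply he i hiU
      have e2 := Finset.card_erase_add_one hiU
      have e1 : (U.erase i ∩ N1).card + 1 = (U ∩ N1).card := by
        rw [Finset.erase_inter]; exact Finset.card_erase_add_one hi
      have e3 : U ∩ N2 = N2 := Finset.inter_eq_right.mpr hj
      have e4 : (V ∩ N2).card ≤ N2.card := aux_le1 V
      rw [aux_card h2 U, e3] at e2
      refine aux_dom hsg h2 _ V _ rfl (by omega) ?_ hV
      rw [aux_card h2 V]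
      omega
  · have h3 : (V ∩ N2).card < (U ∩ N2).card := by omega
    have : (U ∩ N2).Nonempty := by rw [← Finset.card_pos]; omega
    obtain ⟨i, hi⟩ := this
    obtain ⟨hiU, hi2⟩ := Finset.mem_inter.mp hi
    apply he i hiU
    have hi1 : i ∉ N1 := fun h => aux_notmem h2 i h hi2
    have e2 := Finset.card_erase_add_one hiU
    have e1 : (U.erase i ∩ N1) = (U ∩ N1) := by
      rw [Finset.erase_inter]
      exact Finset.erase_eq_of_notMem (fun h => hi1 (Finset.mem_inter.mp h).2)
    rw [aux_card h2 U] at e2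
    refine aux_dom hsg h2 _ V _ rfl (by rw [e1]; omega) ?_ hV
    rw [aux_card h2 V]
    omega

/-- `r ≥ 2` gives a shift-min winning and shift-max losing type with difference `(1, -k)`,
`k ≥ 1`. -/
lemma aux_r2 (hsg : SimpleGame n χ) (h2 : TwoTypes χ N1 N2) (hr : 2 ≤ NumWinTypes2 χ N1 N2) :
    ∃ U V, ShiftMinWin χ U ∧ ShiftMaxLose χ V ∧ (U ∩ N1).card = (V ∩ N1).card + 1 ∧
      (U ∩ N2).card + 1 ≤ (V ∩ N2).card := by
  have hfin := Set.finite_of_ncard_ne_zero (s := {p : ℕ × ℕ | ∃ U, ShiftMinWin χ U ∧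
    p = ((U ∩ N1).card, (U ∩ N2).card)}) (by unfold NumWinTypes2 at hr; omega)
  have hlt : 1 < Set.ncard {p : ℕ × ℕ | ∃ U, ShiftMinWin χ U ∧
    p = ((U ∩ N1).card, (U ∩ N2).card)} := hr
  rw [Set.one_lt_ncard hfin] at hlt
  obtain ⟨p, ⟨A, hA, hpA⟩, p', ⟨B, hB, hpB⟩, hne⟩ := hlt
  have main : ∀ A B, ShiftMinWin χ A → ShiftMinWin χ B →
      (B ∩ N1).card < (A ∩ N1).card → ∃ U V, ShiftMinWin χ U ∧ ShiftMaxLose χ V ∧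
      (U ∩ N1).card = (V ∩ N1).card + 1 ∧ (U ∩ N2).card + 1 ≤ (V ∩ N2).card := by
    intro A B hA hB hlt
    have hs : (A ∩ N1).card + (A ∩ N2).card < (B ∩ N1).card + (B ∩ N2).card := by
      by_contra hcon
      have := aux_smw hsg h2 hA hB.1 hlt.le (by omega)
      omega
    have k1 : (A ∩ N1).card ≤ N1.card := aux_le1 A
    have k2 : (B ∩ N2).card ≤ N2.card := aux_le1 B
    obtain ⟨C, hC1, hC2⟩ := aux_exists h2 ((A ∩ N1).card - 1) ((A ∩ N2).card + 1)
      (by omega) (by omega)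
    have hCl : ¬ χ C := by
      intro hC
      have := aux_smw hsg h2 hA hC (by omega) (by omega)
      omega
    obtain ⟨V, hV, hV1, hV2⟩ := aux_max h2 C hCl
    have : (V ∩ N1).card < (A ∩ N1).card := by
      by_contra hcon
      exact hV.1 (aux_dom' hsg h2 A V (by omega) (by omega) hA.1)
    exact ⟨A, V, hA, hV, by omega, by omega⟩
  rcases lt_trichotomy (A ∩ N1).card (B ∩ N1).card with h | h | h
  · exact main B A hB hA h
  · exfalso
    apply hne
    rw [hpA, hpB]
    rcases le_total (A ∩ N2).card (B ∩ N2).card with h' | h'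
    · obtain ⟨e1, e2⟩ := aux_smw hsg h2 hB hA.1 h.le (by omega)
      rw [e1, e2]
    · obtain ⟨e1, e2⟩ := aux_smw hsg h2 hA hB.1 h.ge (by omega)
      rw [e1, e2]
  · exact main A B hA hB h

lemma aux_feas (hsg : SimpleGame n χ) (h2 : TwoTypes χ N1 N2) (hnull : ∀ i, ¬ NullVoter χ i)
    (hr : 2 ≤ NumWinTypes2 χ N1 N2) {w1 w2 q : ℝ} (hf : LPFeasible χ N1 N2 w1 w2 q) :
    1 ≤ w1 ∧ 1 ≤ w2 ∧
    (∀ U, χ U → q ≤ ((U ∩ N1).card : ℝ) * w1 + ((U ∩ N2).card : ℝ) * w2) ∧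
    (∀ U, ¬ χ U → ((U ∩ N1).card : ℝ) * w1 + ((U ∩ N2).card : ℝ) * w2 ≤ q - 1) := by
  obtain ⟨hw1, hw2, hq, hM, hL⟩ := hf
  have h12 : 1 + w2 ≤ w1 := by
    obtain ⟨U, V, hU, hV, e1, e2⟩ := aux_r2 hsg h2 hr
    have a1 := hM U hU
    have a2 := hL V hV
    rw [e1] at a1
    have e2' : ((U ∩ N2).card : ℝ) + 1 ≤ (V ∩ N2).card := by exact_mod_cast e2
    push_cast at a1
    nlinarith
  have hdom : ∀ U V : Finset (Fin n), (U ∩ N1).card ≤ (V ∩ N1).card →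
      (U ∩ N1).card + (U ∩ N2).card ≤ (V ∩ N1).card + (V ∩ N2).card →
      ((U ∩ N1).card : ℝ) * w1 + ((U ∩ N2).card : ℝ) * w2 ≤
      ((V ∩ N1).card : ℝ) * w1 + ((V ∩ N2).card : ℝ) * w2 := by
    intro U V h1 h3
    have h1' : ((U ∩ N1).card : ℝ) ≤ (V ∩ N1).card := by exact_mod_cast h1
    have h3' : ((U ∩ N1).card : ℝ) + (U ∩ N2).card ≤ (V ∩ N1).card + (V ∩ N2).card := by
      exact_mod_cast h3
    nlinarith [mul_nonneg (sub_nonneg.2 h1') (by linarith : 0 ≤ w1 - w2),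
      mul_nonneg (sub_nonneg.2 h3') hw2]
  have hW : ∀ U, χ U → q ≤ ((U ∩ N1).card : ℝ) * w1 + ((U ∩ N2).card : ℝ) * w2 := by
    intro U hU
    obtain ⟨V, hV, k1, k2⟩ := aux_min h2 U hU
    exact (hM V hV).trans (hdom V U k1 k2)
  have hLo : ∀ U, ¬ χ U → ((U ∩ N1).card : ℝ) * w1 + ((U ∩ N2).card : ℝ) * w2 ≤ q - 1 := by
    intro U hU
    obtain ⟨V, hV, k1, k2⟩ := aux_max h2 U hU
    exact (hdom U V k1 k2).trans (hL V hV)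
  refine ⟨by linarith, ?_, hW, hLo⟩
  obtain ⟨j, hj⟩ := h2.2.1
  have hn := hnull j
  unfold NullVoter at hn
  push Not at hn
  obtain ⟨U, hU⟩ := hn
  have hU' : χ (insert j U) ∧ ¬ χ U := by
    rcases hU with h | h
    · exact h
    · exact absurd (hsg.1 U _ (Finset.subset_insert _ _) h.2) h.1
  have hjU : j ∉ U := by
    intro h
    rw [Finset.insert_eq_of_mem h] at hU'
    exact hU'.2 hU'.1
  have hj1 : j ∉ N1 := fun h => aux_notmem h2 j h hj
  have a1 := hW _ hU'.1
  have a2 := hLo _ hU'.2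
  rw [Finset.insert_inter_of_notMem hj1, Finset.insert_inter_of_mem hj,
    Finset.card_insert_of_notMem (fun h => hjU (Finset.mem_inter.mp h).1)] at a1
  push_cast at a1
  linarith

lemma aux_exists_feas (hsg : SimpleGame n χ) (hwt : IsWeighted χ) (h2 : TwoTypes χ N1 N2) :
    ∃ w1 w2 q : ℝ, LPFeasible χ N1 N2 w1 w2 q := by
  obtain ⟨q, w, hrep⟩ := hwt
  have p1 : (0 : ℝ) < N1.card := by exact_mod_cast Finset.card_pos.mpr h2.1
  have p2 : (0 : ℝ) < N2.card := by exact_mod_cast Finset.card_pos.mpr h2.2.1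
  have same : ∀ U (S1 S2 : Finset (Fin n)), S1 ⊆ N1 → S2 ⊆ N2 → S1.card = (U ∩ N1).card →
      S2.card = (U ∩ N2).card → (χ (S1 ∪ S2) ↔ χ U) := by
    intro U S1 S2 h1 h3 c1 c2
    obtain ⟨e1, e2⟩ := aux_union h2 h1 h3
    constructor
    · exact aux_dom' hsg h2 _ _ (by rw [e1, c1]) (by rw [e1, e2, c1, c2])
    · exact aux_dom' hsg h2 _ _ (by rw [e1, c1]) (by rw [e1, e2, c1, c2])
  have hsum : ∀ S1 S2 : Finset (Fin n), S1 ⊆ N1 → S2 ⊆ N2 →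
      ∑ i ∈ S1 ∪ S2, w i = ∑ i ∈ S1, w i + ∑ i ∈ S2, w i := fun S1 S2 h1 h3 =>
    Finset.sum_union (h2.2.2.1.mono h1 h3)
  refine ⟨(∑ i ∈ N1, (w i : ℝ)) / N1.card, (∑ i ∈ N2, (w i : ℝ)) / N2.card, q,
    by positivity, by positivity, by positivity, ?_, ?_⟩
  · intro U hU
    obtain ⟨S1, s1, c1, l1⟩ := aux_avg (fun i => (w i : ℝ)) N1.card N1 rfl _ (aux_le1 U)
    obtain ⟨S2, s2, c2, l2⟩ := aux_avg (fun i => (w i : ℝ)) N2.card N2 rfl _ (aux_le1 U)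
    have hχ := (hrep _).mp ((same U S1 S2 s1 s2 c1 c2).mpr hU.1)
    rw [hsum S1 S2 s1 s2] at hχ
    have hχ' : (q : ℝ) ≤ ∑ i ∈ S1, (w i : ℝ) + ∑ i ∈ S2, (w i : ℝ) := by exact_mod_cast hχ
    have l1' : ∑ i ∈ S1, (w i : ℝ) ≤
        ((U ∩ N1).card : ℝ) * ((∑ i ∈ N1, (w i : ℝ)) / N1.card) := by
      rw [← mul_div_assoc, le_div_iff₀ p1]; linarith
    have l2' : ∑ i ∈ S2, (w i : ℝ) ≤
        ((U ∩ N2).card : ℝ) * ((∑ i ∈ N2, (w i : ℝ)) / N2.card) := by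
      rw [← mul_div_assoc, le_div_iff₀ p2]; linarith
    linarith
  · intro U hU
    obtain ⟨S1, s1, c1, l1⟩ := aux_avg (fun i => -(w i : ℝ)) N1.card N1 rfl _ (aux_le1 U)
    obtain ⟨S2, s2, c2, l2⟩ := aux_avg (fun i => -(w i : ℝ)) N2.card N2 rfl _ (aux_le1 U)
    simp only [Finset.sum_neg_distrib] at l1 l2
    have hχ := (not_congr (hrep _)).mp ((not_congr (same U S1 S2 s1 s2 c1 c2)).mpr hU.1)
    rw [hsum S1 S2 s1 s2] at hχ
    have hχ2 : ∑ i ∈ S1, w i + ∑ i ∈ S2, w i + 1 ≤ q := by omega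
    have hχ' : ∑ i ∈ S1, (w i : ℝ) + ∑ i ∈ S2, (w i : ℝ) + 1 ≤ q := by exact_mod_cast hχ2
    have l1' : ((U ∩ N1).card : ℝ) * ((∑ i ∈ N1, (w i : ℝ)) / N1.card) ≤
        ∑ i ∈ S1, (w i : ℝ) := by
      rw [← mul_div_assoc, div_le_iff₀ p1]; linarith
    have l2' : ((U ∩ N2).card : ℝ) * ((∑ i ∈ N2, (w i : ℝ)) / N2.card) ≤
        ∑ i ∈ S2, (w i : ℝ) := by
      rw [← mul_div_assoc, div_le_iff₀ p2]; linarith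
    linarith

/-- The LP with the quota eliminated. -/
def AuxS (χ : Finset (Fin n) → Prop) (N1 N2 : Finset (Fin n)) (w1 w2 : ℝ) : Prop :=
  0 ≤ w1 ∧ 0 ≤ w2 ∧ ∀ U V, ShiftMinWin χ U → ShiftMaxLose χ V →
    1 ≤ (((U ∩ N1).card : ℝ) - (V ∩ N1).card) * w1 + (((U ∩ N2).card : ℝ) - (V ∩ N2).card) * w2

lemma AuxS.of_feas {w1 w2 q : ℝ} (h : LPFeasible χ N1 N2 w1 w2 q) : AuxS χ N1 N2 w1 w2 := by
  obtain ⟨h1, h2, -, hM, hL⟩ := h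
  refine ⟨h1, h2, fun U V hU hV => ?_⟩
  have := hM U hU
  have := hL V hV
  linarith

/-- Given the reduced LP, the least quota is attained at a losing coalition. -/
lemma AuxS.exists_feas (hsg : SimpleGame n χ) (h2 : TwoTypes χ N1 N2) {w1 w2 : ℝ}
    (h : AuxS χ N1 N2 w1 w2) :
    ∃ V, ShiftMaxLose χ V ∧ LPFeasible χ N1 N2 w1 w2
      (((V ∩ N1).card : ℝ) * w1 + ((V ∩ N2).card : ℝ) * w2 + 1) := by
  classical
  obtain ⟨V0, hV0, -⟩ := aux_max h2 ∅ hsg.2.1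
  obtain ⟨V, hV, hmax⟩ := Finset.exists_max_image
    (Finset.univ.filter fun U : Finset (Fin n) => ShiftMaxLose χ U)
    (fun V => ((V ∩ N1).card : ℝ) * w1 + ((V ∩ N2).card : ℝ) * w2) ⟨V0, by simp [hV0]⟩
  simp only [Finset.mem_filter, Finset.mem_univ, true_and] at hV hmax
  obtain ⟨k1, k2, k3⟩ := h
  refine ⟨V, hV, k1, k2, by positivity, ?_, ?_⟩
  · intro U hU
    have := k3 U V hU hV
    linarith
  · intro U hU
    have := hmax U hU
    linarith

lemma AuxS.inf_closed (hpos : ∀ w1 w2, AuxS χ N1 N2 w1 w2 → 1 ≤ w1 ∧ 1 ≤ w2) {a b c d : ℝ}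
    (h : AuxS χ N1 N2 a b) (h' : AuxS χ N1 N2 c d) : AuxS χ N1 N2 (min a c) (min b d) := by
  obtain ⟨a1, b1⟩ := hpos _ _ h
  obtain ⟨c1, d1⟩ := hpos _ _ h'
  refine ⟨le_min h.1 h'.1, le_min h.2.1 h'.2.1, fun U V hU hV => ?_⟩
  have e1 := h.2.2 U V hU hV
  have e2 := h'.2.2 U V hU hV
  have hm1 : 1 ≤ min a c := le_min a1 c1
  have hm2 : 1 ≤ min b d := le_min b1 d1
  by_cases hx : (U ∩ N1).card ≤ (V ∩ N1).card
  · have hx' : ((U ∩ N1).card : ℝ) - (V ∩ N1).card ≤ 0 := by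
      rw [sub_nonpos]; exact_mod_cast hx
    rcases min_choice b d with hb | hb <;> rw [hb]
    · have := mul_le_mul_of_nonpos_left (min_le_left a c) hx'
      linarith
    · have := mul_le_mul_of_nonpos_left (min_le_right a c) hx'
      linarith
  · by_cases hy : (U ∩ N2).card ≤ (V ∩ N2).card
    · have hy' : ((U ∩ N2).card : ℝ) - (V ∩ N2).card ≤ 0 := by
        rw [sub_nonpos]; exact_mod_cast hy
      rcases min_choice a c with hb | hb <;> rw [hb]
      · have := mul_le_mul_of_nonpos_left (min_le_left b d) hy'
        linarith
      · have := mul_le_mul_of_nonpos_left (min_le_right b d) hy'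
        linarith
    · have hx' : (1 : ℝ) ≤ ((U ∩ N1).card : ℝ) - (V ∩ N1).card := by
        rw [le_sub_iff_add_le]
        have : 1 + (V ∩ N1).card ≤ (U ∩ N1).card := by omega
        exact_mod_cast this
      have hy' : (0 : ℝ) ≤ ((U ∩ N2).card : ℝ) - (V ∩ N2).card := by
        rw [sub_nonneg]
        have : (V ∩ N2).card ≤ (U ∩ N2).card := by omega
        exact_mod_cast this
      nlinarith [mul_nonneg hy' (by linarith : 0 ≤ min b d)]

lemma AuxS.exists_least (hpos : ∀ w1 w2, AuxS χ N1 N2 w1 w2 → 1 ≤ w1 ∧ 1 ≤ w2) {a b : ℝ}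
    (h : AuxS χ N1 N2 a b) :
    ∃ u v, AuxS χ N1 N2 u v ∧ ∀ c d, AuxS χ N1 N2 c d → u ≤ c ∧ v ≤ d := by
  have hclosed : IsClosed {p : ℝ × ℝ | AuxS χ N1 N2 p.1 p.2} := by
    simp only [AuxS, Set.ofPred_and, Set.ofPred_forall]
    refine (isClosed_le (by fun_prop) (by fun_prop)).inter
      ((isClosed_le (by fun_prop) (by fun_prop)).inter ?_)
    refine isClosed_iInter fun U => isClosed_iInter fun V => isClosed_iInter fun _ =>
      isClosed_iInter fun _ => isClosed_le (by fun_prop) (by fun_prop)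
  have hcomp : IsCompact (Set.Icc ((0 : ℝ), (0 : ℝ)) (a, b) ∩
      {p : ℝ × ℝ | AuxS χ N1 N2 p.1 p.2}) := isCompact_Icc.inter_right hclosed
  obtain ⟨p, ⟨hp1, hp2⟩, hmin⟩ := hcomp.exists_isMinOn
    (f := fun p : ℝ × ℝ => p.1 + p.2) ⟨(a, b), ⟨⟨h.1, h.2.1⟩, le_rfl⟩, h⟩ (by fun_prop)
  refine ⟨p.1, p.2, hp2, fun c d hcd => ?_⟩
  have hm := AuxS.inf_closed hpos hp2 hcd
  have hin : (Min.min p.1 c, Min.min p.2 d) ∈ Set.Icc ((0 : ℝ), (0 : ℝ)) (a, b) ∩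
      {p : ℝ × ℝ | AuxS χ N1 N2 p.1 p.2} :=
    ⟨⟨⟨hm.1, hm.2.1⟩, ⟨(min_le_left _ _).trans hp1.2.1, (min_le_left _ _).trans hp1.2.2⟩⟩, hm⟩
  have hle : p.1 + p.2 ≤ Min.min p.1 c + Min.min p.2 d := hmin hin
  have i1 := min_le_left p.1 c
  have i2 := min_le_left p.2 d
  have i3 := min_le_right p.1 c
  have i4 := min_le_right p.2 d
  constructor <;> linarith

end aux

theorem stmt19 (n : ℕ) (χ : Finset (Fin n) → Prop) (hsg : SimpleGame n χ)
    (hwt : IsWeighted χ) (N1 N2 : Finset (Fin n)) (h2 : TwoTypes χ N1 N2)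
    (hnull : ∀ i, ¬ NullVoter χ i) (hr : 2 ≤ NumWinTypes2 χ N1 N2) :
    ∃ W1 W2 Q : ℕ, LPFeasible χ N1 N2 (W1 : ℝ) (W2 : ℝ) (Q : ℝ) ∧
      ∀ w1 w2 q : ℝ, LPFeasible χ N1 N2 w1 w2 q →
        (W1 : ℝ) ≤ w1 ∧ (W2 : ℝ) ≤ w2 ∧ (Q : ℝ) ≤ q := by
  have hpos : ∀ w1 w2, AuxS χ N1 N2 w1 w2 → 1 ≤ w1 ∧ 1 ≤ w2 := by
    intro w1 w2 h
    obtain ⟨V, -, hf⟩ := h.exists_feas hsg h2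
    have := aux_feas hsg h2 hnull hr hf
    exact ⟨this.1, this.2.1⟩
  obtain ⟨a, b, q0, hf0⟩ := aux_exists_feas hsg hwt h2
  obtain ⟨u, v, huv, hleast⟩ := AuxS.exists_least hpos (AuxS.of_feas hf0)
  obtain ⟨V, hV, hfeas⟩ := huv.exists_feas hsg h2
  obtain ⟨hu1, hv1, hwin, hlose⟩ := aux_feas hsg h2 hnull hr hfeas
  obtain ⟨Q, hQ⟩ : ∃ Q : ℝ, Q = ((V ∩ N1).card : ℝ) * u + ((V ∩ N2).card : ℝ) * v + 1 :=
    ⟨_, rfl⟩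
  rw [← hQ] at hfeas hwin hlose
  -- tight constraints
  obtain ⟨⟨⟨m, l⟩, hm, hl⟩, hml1, hml2⟩ := aux_tight
    (ι := {p : Finset (Fin n) × Finset (Fin n) // ShiftMinWin χ p.1 ∧ ShiftMaxLose χ p.2})
    (fun p => (((p.1.1 ∩ N2).card : ℝ) - (p.1.2 ∩ N2).card) * v)
    (fun p => ((p.1.1 ∩ N1).card : ℝ) - (p.1.2 ∩ N1).card) u (by linarith)
    (fun p => by have := huv.2.2 _ _ p.2.1 p.2.2; linarith)
    (fun y hy h => (hleast y v ⟨hy, by linarith, fun U V hU hV => by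
      have := h ⟨(U, V), hU, hV⟩
      simp only at this
      linarith⟩).1)
  obtain ⟨⟨⟨m', l'⟩, hm', hl'⟩, hml1', hml2'⟩ := aux_tight
    (ι := {p : Finset (Fin n) × Finset (Fin n) // ShiftMinWin χ p.1 ∧ ShiftMaxLose χ p.2})
    (fun p => (((p.1.1 ∩ N1).card : ℝ) - (p.1.2 ∩ N1).card) * u)
    (fun p => ((p.1.1 ∩ N2).card : ℝ) - (p.1.2 ∩ N2).card) v (by linarith)
    (fun p => by have := huv.2.2 _ _ p.2.1 p.2.2; linarith)
    (fun y hy h => (hleast u y ⟨by linarith, hy, fun U V hU hV => by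
      have := h ⟨(U, V), hU, hV⟩
      simp only at this
      linarith⟩).2)
  simp only at hm hl hm' hl' hml1 hml2 hml1' hml2'
  have fm := hwin m hm.1
  have fl := hlose l hl.1
  have fm' := hwin m' hm'.1
  have fl' := hlose l' hl'.1
  have gm : ((m ∩ N1).card : ℝ) * u + ((m ∩ N2).card : ℝ) * v = Q := by linarith
  have gl : ((l ∩ N1).card : ℝ) * u + ((l ∩ N2).card : ℝ) * v = Q - 1 := by linarith
  have gm' : ((m' ∩ N1).card : ℝ) * u + ((m' ∩ N2).card : ℝ) * v = Q := by linarith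
  have gl' : ((l' ∩ N1).card : ℝ) * u + ((l' ∩ N2).card : ℝ) * v = Q - 1 := by linarith
  have hstrip : ∀ x y : ℤ, 0 ≤ x → x ≤ (N1.card : ℤ) → 0 ≤ y → y ≤ (N2.card : ℤ) →
      ¬ (Q - 1 < x * u + y * v ∧ x * u + y * v < Q) := by
    rintro x y hx hx' hy hy' ⟨k1, k2⟩
    lift x to ℕ using hx
    lift y to ℕ using hy
    obtain ⟨U, e1, e2⟩ := aux_exists h2 x y (by exact_mod_cast hx') (by exact_mod_cast hy')
    push_cast at k1 k2
    rw [← e1, ← e2] at k1 k2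
    by_cases hU : χ U
    · have := hwin U hU
      linarith
    · have := hlose U hU
      linarith
  have hbox1 : ∀ U : Finset (Fin n), (0 : ℤ) ≤ ((U ∩ N1).card : ℤ) ∧
      ((U ∩ N1).card : ℤ) ≤ (N1.card : ℤ) := fun U =>
    ⟨by positivity, by exact_mod_cast aux_le1 U⟩
  have hbox2 : ∀ U : Finset (Fin n), (0 : ℤ) ≤ ((U ∩ N2).card : ℤ) ∧
      ((U ∩ N2).card : ℤ) ≤ (N2.card : ℤ) := fun U =>
    ⟨by positivity, by exact_mod_cast aux_le1 U⟩
  have hint : ∀ e1 e2 : ℤ, ∃ k : ℤ, e1 * u + e2 * v = k := by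
    intro e1 e2
    by_cases hmm : (m ∩ N1).card = (m' ∩ N1).card ∧ (m ∩ N2).card = (m' ∩ N2).card
    · have hll : ¬ ((l ∩ N1).card = (l' ∩ N1).card ∧ (l ∩ N2).card = (l' ∩ N2).card) := by
        rintro ⟨x1, x2⟩
        rw [← hmm.2, ← x2] at hml1'
        have y1 : (l ∩ N1).card + 1 ≤ (m ∩ N1).card := by
          have : ((l ∩ N1).card : ℝ) < (m ∩ N1).card := by linarith
          exact_mod_cast this
        have y1' : ((l ∩ N1).card : ℝ) + 1 ≤ (m ∩ N1).card := by exact_mod_cast y1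
        nlinarith [mul_pos hml1' (by linarith : 0 < v)]
      obtain ⟨k, hk⟩ := aux_tri N1.card N2.card (-u) (-v) (1 - Q) (by linarith)
        (l ∩ N1).card (l ∩ N2).card (l' ∩ N1).card (l' ∩ N2).card (m ∩ N1).card (m ∩ N2).card
        (hbox1 _) (hbox2 _) (hbox1 _) (hbox2 _) (hbox1 _) (hbox2 _)
        (fun x y hx hx' hy hy' ⟨k1, k2⟩ => hstrip x y hx hx' hy hy'
          ⟨by linarith, by linarith⟩)
        (by push_cast; linarith) (by push_cast; linarith) (by exact_mod_cast hll)
        (by push_cast; linarith) e1 e2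
      exact ⟨-k, by push_cast; linarith⟩
    · exact aux_tri N1.card N2.card u v Q (by linarith)
        (m ∩ N1).card (m ∩ N2).card (m' ∩ N1).card (m' ∩ N2).card (l ∩ N1).card (l ∩ N2).card
        (hbox1 _) (hbox2 _) (hbox1 _) (hbox2 _) (hbox1 _) (hbox2 _) hstrip
        (by push_cast; linarith) (by push_cast; linarith) (by exact_mod_cast hmm)
        (by push_cast; linarith) e1 e2
  obtain ⟨k1, hk1⟩ := hint 1 0
  obtain ⟨k2, hk2⟩ := hint 0 1
  have hk1' : u = k1 := by push_cast at hk1; linarith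
  have hk2' : v = k2 := by push_cast at hk2; linarith
  have p1 : 0 ≤ k1 := by
    have : (0 : ℝ) ≤ k1 := by linarith
    exact_mod_cast this
  have p2 : 0 ≤ k2 := by
    have : (0 : ℝ) ≤ k2 := by linarith
    exact_mod_cast this
  lift k1 to ℕ using p1
  lift k2 to ℕ using p2
  have hk1 : (k1 : ℝ) = u := by rw [hk1']; simp
  have hk2 : (k2 : ℝ) = v := by rw [hk2']; simp
  have hQ' : (((V ∩ N1).card * k1 + (V ∩ N2).card * k2 + 1 : ℕ) : ℝ) = Q := by
    push_cast
    rw [hk1, hk2, hQ]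
  refine ⟨k1, k2, (V ∩ N1).card * k1 + (V ∩ N2).card * k2 + 1, ?_, ?_⟩
  · rw [hQ', hk1, hk2]
    exact hfeas
  · intro w1 w2 q hf
    rw [hQ', hk1, hk2]
    obtain ⟨l1, l2⟩ := hleast w1 w2 (AuxS.of_feas hf)
    refine ⟨l1, l2, ?_⟩
    have := hf.2.2.2.2 V hV
    have i1 := mul_le_mul_of_nonneg_left l1 (Nat.cast_nonneg (α := ℝ) (V ∩ N1).card)
    have i2 := mul_le_mul_of_nonneg_left l2 (Nat.cast_nonneg (α := ℝ) (V ∩ N2).card)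
    linarith
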